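/- Let Y and Y' be centered Gaussian n×m random matrices, let β > 0, δ > 0, τ > 1/(β(1+δ)), and let g : ℝ → ℝ be a smooth function with ‖g'‖_∞ ≤ τ⁻¹, ‖g''‖_∞ ≤ C₀ β(1+δ) τ⁻¹ for some constant C₀. Then, writing f = g ∘ F^{βδ}, one has |E[f(Y)] − E[f(Y')]| ≤ (C β(1+δ)/τ) · max_{i₁,j₁,i₂,j₂} |E[Y_{i₁,j₁}Y_{i₂,j₂} − Y'_{i₁,j₁}Y'_{i₂,j₂}]|, where C depends only on C₀ and the maximum is over 1 ≤ i₁,i₂ ≤ n and 1 ≤ j₁,j₂ ≤ m. -/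

import Mathlib

open MeasureTheory ProbabilityTheory Real

/-- The smooth min-max approximation `F^{βδ}`. -/
noncomputable def Fbd (β δ : ℝ) {n m : ℕ} (x : Fin n → Fin m → ℝ) : ℝ :=
  -(1 / (β * δ)) * Real.log (∑ i, (∑ j, Real.exp (β * x i j)) ^ (-δ))

/-- `X` is a centered (jointly) Gaussian random matrix under `P`: every linear combination
of its entries has a centered real Gaussian distribution. -/
def IsCenteredGaussianMatrix {Ω : Type*} [MeasurableSpace Ω] (P : Measure Ω)
    {n m : ℕ} (X : Ω → Fin n → Fin m → ℝ) : Prop :=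
  ∀ c : Fin n → Fin m → ℝ, ∃ v : NNReal,
    Measure.map (fun ω => ∑ i, ∑ j, c i j * X ω i j) P = gaussianReal 0 v

/-- `f1` is the gradient of `f`: the chain rule holds along every differentiable curve. -/
def HasGradientAlongCurves {ι : Type*} [Fintype ι] (f : (ι → ℝ) → ℝ) (f1 : ι → (ι → ℝ) → ℝ) :
    Prop :=
  ∀ (x : ℝ → ι → ℝ) (u : ι → ℝ) (t : ℝ), (∀ a, HasDerivAt (fun s => x s a) (u a) t) →
    HasDerivAt (fun s => f (x s)) (∑ a, f1 a (x t) * u a) t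

/-- Gaussian integration by parts on the line. -/
lemma integral_mul_gaussianReal_eq_variance_mul_integral_deriv {h h' : ℝ → ℝ} {A B : ℝ}
    (hd : ∀ x, HasDerivAt h (h' x) x) (hA : ∀ x, |h x| ≤ A) (hB : ∀ x, |h' x| ≤ B) (v : NNReal) :
    ∫ x, x * h x ∂(gaussianReal 0 v) = v * ∫ x, h' x ∂(gaussianReal 0 v) := by
  rcases eq_or_ne v 0 with rfl | hv
  · simp [gaussianReal_zero_var]
  have hv' : (v : ℝ) ≠ 0 := by exact_mod_cast hv
  have hmh : Measurable h :=
    (continuous_iff_continuousAt.2 fun x => (hd x).continuousAt).measurable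
  have hmh' : Measurable h' := by
    rw [show h' = deriv h from funext fun x => (hd x).deriv.symm]
    exact measurable_deriv h
  have hid : Integrable (fun x => gaussianPDFReal 0 v x * x) := by
    have h1 : Integrable (id : ℝ → ℝ) (gaussianReal 0 v) :=
      memLp_one_iff_integrable.1 (memLp_id_gaussianReal 1)
    rw [gaussianReal_of_var_ne_zero 0 hv, integrable_withDensity_iff_integrable_smul'
      (measurable_gaussianPDF 0 v) (by simp [gaussianPDF_lt_top])] at h1
    simpa [toReal_gaussianPDF] using h1
  have hp : ∀ x, HasDerivAt (gaussianPDFReal 0 v) (-(x / v) * gaussianPDFReal 0 v x) x := by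
    intro x
    have h1 : HasDerivAt (fun y : ℝ => -(y - 0) ^ 2 / (2 * v)) (-(x / v)) x := by
      have := (((hasDerivAt_id x).sub_const 0).pow 2).neg.div_const (2 * (v : ℝ))
      refine this.congr_deriv ?_
      simp only [id, Nat.cast_ofNat]
      field_simp
      ring
    have h2 := (h1.exp).const_mul (√(2 * π * v))⁻¹
    rw [gaussianPDFReal_def]
    refine h2.congr_deriv ?_
    ring
  have hi1 : Integrable (fun x => gaussianPDFReal 0 v x * h' x) :=
    (integrable_gaussianPDFReal 0 v).mul_bdd (c := B) hmh'.aestronglyMeasurable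
      (ae_of_all _ hB)
  have hi2 : Integrable (fun x => gaussianPDFReal 0 v x * x * h x) :=
    hid.mul_bdd (c := A) hmh.aestronglyMeasurable (ae_of_all _ hA)
  have hi3 : Integrable (fun x => gaussianPDFReal 0 v x * h x) :=
    (integrable_gaussianPDFReal 0 v).mul_bdd (c := A) hmh.aestronglyMeasurable
      (ae_of_all _ hA)
  have key := integral_eq_zero_of_hasDerivAt_of_integrable
    (f := fun x => gaussianPDFReal 0 v x * h x)
    (f' := fun x => gaussianPDFReal 0 v x * h' x - (v : ℝ)⁻¹ * (gaussianPDFReal 0 v x * x * h x))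
    (fun x => by
      refine ((hp x).mul (hd x)).congr_deriv ?_
      ring) (hi1.sub (hi2.const_mul _)) hi3
  rw [integral_sub hi1 (hi2.const_mul _), integral_const_mul] at key
  simp only [integral_gaussianReal_eq_integral_smul hv, smul_eq_mul]
  rw [sub_eq_zero.1 key, mul_inv_cancel_left₀ hv']
  simp only [mul_assoc]

/-- Gaussian integration by parts for a jointly Gaussian pair of a scalar and a vector. -/
lemma integral_mul_comp_eq_sum_covariance_mul_integral {Ω : Type*} [MeasurableSpace Ω]
    {P : Measure Ω} {ι : Type*} [Fintype ι] {U : Ω → ℝ} {W : Ω → ι → ℝ}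
    (hUW : HasGaussianLaw (fun ω => (U ω, W ω)) P) (hU0 : P[U] = 0)
    {h : (ι → ℝ) → ℝ} {h1 : ι → (ι → ℝ) → ℝ} (hd : HasGradientAlongCurves h h1)
    (hc : Continuous h) (hc1 : ∀ b, Continuous (h1 b)) {A B : ℝ}
    (hA : ∀ x, |h x| ≤ A) (hB : ∀ b x, |h1 b x| ≤ B) :
    ∫ ω, U ω * h (W ω) ∂P = ∑ b, cov[U, fun ω => W ω b; P] * ∫ ω, h1 b (W ω) ∂P := by
  have := hUW.isProbabilityMeasure
  have hU : HasGaussianLaw U P := hUW.fst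
  have hW : HasGaussianLaw W P := hUW.snd
  have hWb : ∀ b, HasGaussianLaw (fun ω => W ω b) P := fun b => hW.map_fun (.proj b)
  rcases eq_or_ne Var[U; P] 0 with hv | hv
  · have hUae : U =ᵐ[P] fun _ => 0 := by
      rw [← hU0]
      exact ae_eq_integral_of_variance_eq_zero hU.memLp_two hv
    have h1 : ∫ ω, U ω * h (W ω) ∂P = 0 := by
      apply integral_eq_zero_of_ae
      filter_upwards [hUae] with ω hω
      simp [hω]
    rw [h1, Finset.sum_eq_zero]
    intro b _
    have h2 : cov[U, fun ω => W ω b; P] = 0 := by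
      rw [covariance, hU0]
      apply integral_eq_zero_of_ae
      filter_upwards [hUae] with ω hω
      simp [hω]
    rw [h2, zero_mul]
  set v := Var[U; P] with hvdef
  set c : ι → ℝ := fun b => cov[U, fun ω => W ω b; P] with hcdef
  let R : Ω → ι → ℝ := fun ω b => W ω b - c b / v * U ω
  have hUR : HasGaussianLaw (fun ω => ((fun _ : Unit => U ω), fun b => R ω b)) P := by
    let L : ℝ × (ι → ℝ) →L[ℝ] (Unit → ℝ) × (ι → ℝ) :=
      (ContinuousLinearMap.pi fun _ => .fst ℝ ℝ (ι → ℝ)).prod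
        (ContinuousLinearMap.pi fun b => (ContinuousLinearMap.proj b).comp (.snd ℝ ℝ (ι → ℝ)) -
          (c b / v) • .fst ℝ ℝ (ι → ℝ))
    exact hUW.map_fun L
  have hind : IndepFun U R P := by
    have h0 := HasGaussianLaw.indepFun_of_covariance_eval (X := fun _ : Unit => U)
      (Y := fun b ω => R ω b) hUR (fun _ b => by
        change cov[U, (fun ω => W ω b) - (fun ω => c b / v * U ω); P] = 0
        rw [covariance_sub_right hU.memLp_two (hWb b).memLp_two (hU.memLp_two.const_mul _),
          covariance_const_mul_right, covariance_self hU.aemeasurable]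
        change c b - c b / v * v = 0
        field_simp
        ring)
    exact h0.comp (φ := fun f : Unit → ℝ => f ()) (ψ := id) (measurable_pi_apply _) measurable_id
  have hUm : AEMeasurable U P := hU.aemeasurable
  have hRm : AEMeasurable R P := hUR.snd.aemeasurable
  have hlaw := (indepFun_iff_map_prod_eq_prod_map_map hUm hRm).1 hind
  have hUlaw : P.map U = gaussianReal 0 v.toNNReal := by
    rw [hU.map_eq_gaussianReal, hU0]
  have hvnn : (v.toNNReal : ℝ) = v := Real.coe_toNNReal _ (variance_nonneg _ _)
  have hWR : ∀ ω, W ω = fun b => R ω b + c b / v * U ω := fun ω => by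
    ext b; simp [R]
  let T : ℝ × (ι → ℝ) → ι → ℝ := fun p b => p.2 b + c b / v * p.1
  have hT : Continuous T := by fun_prop
  have := Measure.isProbabilityMeasure_map (μ := P) hRm
  have transfer : ∀ k : ℝ × (ι → ℝ) → ℝ, Continuous k →
      Integrable k ((gaussianReal 0 v.toNNReal).prod (P.map R)) →
      ∫ ω, k (U ω, R ω) ∂P = ∫ r, ∫ u, k (u, r) ∂(gaussianReal 0 v.toNNReal) ∂(P.map R) := by
    intro k hk hki
    rw [← integral_prod_symm _ hki, ← hUlaw, ← hlaw, integral_map (hUm.prodMk hRm)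
      hk.aestronglyMeasurable]
  have hUi : Integrable (fun p : ℝ × (ι → ℝ) => p.1)
      ((gaussianReal 0 v.toNNReal).prod (P.map R)) := by
    have h1 : Integrable (id : ℝ → ℝ) (gaussianReal 0 v.toNNReal) :=
      memLp_one_iff_integrable.1 (memLp_id_gaussianReal 1)
    exact h1.comp_fst _
  have hib : ∀ b, Integrable (fun p => h1 b (T p))
      ((gaussianReal 0 v.toNNReal).prod (P.map R)) := fun b =>
    Integrable.of_bound ((hc1 b).comp hT).aestronglyMeasurable B (ae_of_all _ fun p => hB b _)
  have e1 : ∫ ω, U ω * h (W ω) ∂P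
      = ∫ r, ∫ u, u * h (T (u, r)) ∂(gaussianReal 0 v.toNNReal) ∂(P.map R) := by
    rw [← transfer (fun p => p.1 * h (T p)) (continuous_fst.mul (hc.comp hT))
      (hUi.mul_bdd (c := A) (hc.comp hT).aestronglyMeasurable (ae_of_all _ fun p => hA _))]
    exact integral_congr_ae (ae_of_all _ fun ω => by simp only [T]; rw [hWR ω])
  have e2 : ∀ r, ∫ u, u * h (T (u, r)) ∂(gaussianReal 0 v.toNNReal)
      = ∫ u, ∑ b, c b * h1 b (T (u, r)) ∂(gaussianReal 0 v.toNNReal) := by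
    intro r
    have := integral_mul_gaussianReal_eq_variance_mul_integral_deriv
      (h := fun u => h (T (u, r))) (h' := fun u => ∑ b, h1 b (T (u, r)) * (c b / v))
      (A := A) (B := ∑ b, B * |c b / v|)
      (fun u => hd (fun u => T (u, r)) (fun b => c b / v) u fun b => by
        simpa [T] using ((hasDerivAt_id' u).const_mul (c b / v)).const_add (r b))
      (fun u => hA _) (fun u => (Finset.abs_sum_le_sum_abs _ _).trans
        (Finset.sum_le_sum fun b _ => by
          rw [abs_mul]; exact mul_le_mul_of_nonneg_right (hB _ _) (abs_nonneg _))) v.toNNReal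
    rw [this, hvnn, ← integral_const_mul]
    refine integral_congr_ae (ae_of_all _ fun u => ?_)
    simp only [Finset.mul_sum]
    refine Finset.sum_congr rfl fun b _ => ?_
    field_simp
  have hsum : Integrable (fun p => ∑ b, c b * h1 b (T p))
      ((gaussianReal 0 v.toNNReal).prod (P.map R)) :=
    integrable_finsetSum _ fun b _ => (hib b).const_mul _
  rw [e1]
  simp_rw [e2]
  rw [← transfer (fun p => ∑ b, c b * h1 b (T p))
    (continuous_finsetSum _ fun b _ => continuous_const.mul ((hc1 b).comp hT)) hsum]
  have hiW : ∀ b, Integrable (fun ω => h1 b (W ω)) P := fun b =>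
    Integrable.of_bound ((hc1 b).comp_aestronglyMeasurable hW.aemeasurable.aestronglyMeasurable) B
      (ae_of_all _ fun p => hB b _)
  have e3 : ∀ ω, T (U ω, R ω) = W ω := fun ω => (hWR ω).symm
  simp_rw [e3]
  rw [integral_finsetSum _ fun b _ => (hiW b).const_mul _]
  simp_rw [integral_const_mul]
  rfl

lemma HasGradientAlongCurves.abs_le {ι : Type*} [Fintype ι] {f : (ι → ℝ) → ℝ}
    {f1 : ι → (ι → ℝ) → ℝ} (hf : HasGradientAlongCurves f f1) {A : ℝ}
    (hA : ∀ a x, |f1 a x| ≤ A) (x : ι → ℝ) : |f x| ≤ |f 0| + ∑ a, A * |x a| := by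
  have hd : ∀ s : ℝ, HasDerivAt (fun s : ℝ => f (fun a => s * x a))
      (∑ a, f1 a (fun a => s * x a) * x a) s := fun s =>
    hf (fun s a => s * x a) x s fun a => by simpa using (hasDerivAt_id' s).mul_const (x a)
  have := Convex.norm_image_sub_le_of_norm_hasDerivWithin_le (s := Set.univ)
    (C := ∑ a, A * |x a|) (fun s _ => (hd s).hasDerivWithinAt) (fun s _ => by
      rw [Real.norm_eq_abs]
      refine (Finset.abs_sum_le_sum_abs _ _).trans (Finset.sum_le_sum fun a _ => ?_)
      rw [abs_mul]
      exact mul_le_mul_of_nonneg_right (hA _ _) (abs_nonneg _))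
    convex_univ (Set.mem_univ 0) (Set.mem_univ 1)
  simp only [one_mul, zero_mul, sub_zero, norm_one, mul_one, Real.norm_eq_abs] at this
  have h0 : (fun _ : ι => (0 : ℝ)) = 0 := rfl
  rw [h0] at this
  have := abs_sub_abs_le_abs_sub (f x) (f 0)
  linarith

section Interpolation

variable {Ω ι : Type*} [MeasurableSpace Ω] [Fintype ι] {Q : Measure Ω} {X X' : Ω → ι → ℝ}

/-- The covariance between the path `cos θ • X + sin θ • X'` and its velocity. -/
lemma covariance_rotation_velocity (hX : HasGaussianLaw X Q) (hX' : HasGaussianLaw X' Q)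
    (hind : IndepFun X X' Q) (h0 : ∀ a, ∫ ω, X ω a ∂Q = 0) (h0' : ∀ a, ∫ ω, X' ω a ∂Q = 0)
    (θ : ℝ) (a b : ι) :
    cov[fun ω => -sin θ * X ω a + cos θ * X' ω a, fun ω => cos θ * X ω b + sin θ * X' ω b; Q] =
      -(sin θ * cos θ * (∫ ω, X ω a * X ω b ∂Q - ∫ ω, X' ω a * X' ω b ∂Q)) := by
  have := hX.isProbabilityMeasure
  have hm : ∀ a, MemLp (fun ω => X ω a) 2 Q := fun a => (hX.map_fun (.proj a)).memLp_two
  have hm' : ∀ a, MemLp (fun ω => X' ω a) 2 Q := fun a => (hX'.map_fun (.proj a)).memLp_two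
  have hcross : ∀ a b, ∫ ω, X ω a * X' ω b ∂Q = 0 := fun a b => by
    have := (hind.comp (measurable_pi_apply a) (measurable_pi_apply b)).integral_mul_eq_mul_integral
      (hm a).aestronglyMeasurable (hm' b).aestronglyMeasurable
    simp only [Function.comp_def, Pi.mul_apply, h0, zero_mul] at this
    exact this
  have hi1 : Integrable (fun ω => X ω a * X ω b) Q := (hm a).integrable_mul (hm b)
  have hi2 : Integrable (fun ω => X ω a * X' ω b) Q := (hm a).integrable_mul (hm' b)
  have hi3 : Integrable (fun ω => X ω b * X' ω a) Q := (hm b).integrable_mul (hm' a)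
  have hi4 : Integrable (fun ω => X' ω a * X' ω b) Q := (hm' a).integrable_mul (hm' b)
  refine (covariance_eq_sub (X := fun ω => -sin θ * X ω a + cos θ * X' ω a)
    (Y := fun ω => cos θ * X ω b + sin θ * X' ω b) (((hm a).const_mul _).add
    ((hm' a).const_mul _)) (((hm b).const_mul _).add ((hm' b).const_mul _))).trans ?_
  have hmean : ∫ ω, (-sin θ * X ω a + cos θ * X' ω a) ∂Q = 0 := by
    rw [integral_add (((hm a).integrable one_le_two).const_mul _)
      (((hm' a).integrable one_le_two).const_mul _), integral_const_mul, integral_const_mul, h0, h0']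
    simp
  rw [hmean, zero_mul, sub_zero]
  have hexp : ∀ ω, ((fun ω => -sin θ * X ω a + cos θ * X' ω a) *
      fun ω => cos θ * X ω b + sin θ * X' ω b) ω =
      -(sin θ * cos θ) * (X ω a * X ω b) + -(sin θ ^ 2) * (X ω a * X' ω b) +
      cos θ ^ 2 * (X ω b * X' ω a) + sin θ * cos θ * (X' ω a * X' ω b) := fun ω => by
    simp only [Pi.mul_apply]
    ring
  have hj2 := (hi1.const_mul (-(sin θ * cos θ))).add (hi2.const_mul (-(sin θ ^ 2)))
  have hj3 := hj2.add (hi3.const_mul (cos θ ^ 2))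
  have e3 := integral_add hj3 (hi4.const_mul (sin θ * cos θ))
  have e2 := integral_add hj2 (hi3.const_mul (cos θ ^ 2))
  have e1 := integral_add (hi1.const_mul (-(sin θ * cos θ))) (hi2.const_mul (-(sin θ ^ 2)))
  simp only [Pi.add_apply] at e2 e3
  rw [integral_congr_ae (ae_of_all _ hexp), e3, e2, e1]
  simp only [integral_const_mul, hcross]
  ring

/-- Comparison of smooth functionals of two independent centered Gaussian vectors. -/
lemma abs_integral_sub_integral_le_of_indepFun [Nonempty ι] (hX : HasGaussianLaw X Q)
    (hX' : HasGaussianLaw X' Q) (hind : IndepFun X X' Q) (h0 : ∀ a, ∫ ω, X ω a ∂Q = 0)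
    (h0' : ∀ a, ∫ ω, X' ω a ∂Q = 0)
    {f : (ι → ℝ) → ℝ} {f1 : ι → (ι → ℝ) → ℝ} {f2 : ι → ι → (ι → ℝ) → ℝ}
    (hf : HasGradientAlongCurves f f1) (hf1 : ∀ a, HasGradientAlongCurves (f1 a) (f2 a))
    (hc : Continuous f) (hc1 : ∀ a, Continuous (f1 a)) (hc2 : ∀ a b, Continuous (f2 a b))
    {A K M : ℝ} (hA : ∀ a x, |f1 a x| ≤ A) (hK : ∀ x, ∑ a, ∑ b, |f2 a b x| ≤ K)
    (hM : ∀ a b, |∫ ω, X ω a * X ω b ∂Q - ∫ ω, X' ω a * X' ω b ∂Q| ≤ M) :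
    |∫ ω, f (X ω) ∂Q - ∫ ω, f (X' ω) ∂Q| ≤ 2 * K * M := by
  have := hX.isProbabilityMeasure
  have hK0 : 0 ≤ K := le_trans (by positivity) (hK 0)
  obtain ⟨a₀⟩ := ‹Nonempty ι›
  have hM0 : 0 ≤ M := (abs_nonneg _).trans (hM a₀ a₀)
  have hXm := hX.aemeasurable
  have hX'm := hX'.aemeasurable
  have hXi : ∀ a, Integrable (fun ω => X ω a) Q := fun a => (hX.map_fun (.proj a)).integrable
  have hX'i : ∀ a, Integrable (fun ω => X' ω a) Q := fun a => (hX'.map_fun (.proj a)).integrable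
  have hB : ∀ a b x, |f2 a b x| ≤ K := fun a b x =>
    ((Finset.single_le_sum (f := fun b => |f2 a b x|) (fun _ _ => abs_nonneg _)
      (Finset.mem_univ b)).trans (Finset.single_le_sum (f := fun a => ∑ b, |f2 a b x|)
      (fun _ _ => by positivity) (Finset.mem_univ a))).trans (hK x)
  let Z : ℝ → Ω → ι → ℝ := fun θ ω a => cos θ * X ω a + sin θ * X' ω a
  let V : ℝ → Ω → ι → ℝ := fun θ ω a => -sin θ * X ω a + cos θ * X' ω a
  have hVZ : ∀ θ a, HasGaussianLaw (fun ω => (V θ ω a, Z θ ω)) Q := fun θ a => by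
    let L : (ι → ℝ) × (ι → ℝ) →L[ℝ] ℝ × (ι → ℝ) :=
      ((ContinuousLinearMap.proj a).comp
        (-sin θ • ContinuousLinearMap.fst ℝ (ι → ℝ) (ι → ℝ) +
          cos θ • ContinuousLinearMap.snd ℝ (ι → ℝ) (ι → ℝ))).prod
      (cos θ • ContinuousLinearMap.fst ℝ (ι → ℝ) (ι → ℝ) +
        sin θ • ContinuousLinearMap.snd ℝ (ι → ℝ) (ι → ℝ))
    exact (hind.hasGaussianLaw hX hX').map_fun L
  have hZ : ∀ θ, AEStronglyMeasurable (Z θ) Q := fun θ => by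
    have h1 : Continuous fun p : (ι → ℝ) × (ι → ℝ) => fun a => cos θ * p.1 a + sin θ * p.2 a := by
      fun_prop
    exact h1.comp_aestronglyMeasurable (hXm.prodMk hX'm).aestronglyMeasurable
  have hZle : ∀ θ ω a, |Z θ ω a| ≤ |X ω a| + |X' ω a| := fun θ ω a => by
    refine (abs_add_le _ _).trans (add_le_add ?_ ?_) <;> rw [abs_mul]
    · exact mul_le_of_le_one_left (abs_nonneg _) (abs_cos_le_one θ)
    · exact mul_le_of_le_one_left (abs_nonneg _) (abs_sin_le_one θ)
  have hVle : ∀ θ ω a, |V θ ω a| ≤ |X ω a| + |X' ω a| := fun θ ω a => by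
    refine (abs_add_le _ _).trans (add_le_add ?_ ?_) <;> rw [abs_mul]
    · rw [abs_neg]
      exact mul_le_of_le_one_left (abs_nonneg _) (abs_sin_le_one θ)
    · exact mul_le_of_le_one_left (abs_nonneg _) (abs_cos_le_one θ)
  have hA0 : 0 ≤ A := (abs_nonneg _).trans (hA a₀ 0)
  have hbound : Integrable (fun ω => ∑ a, A * (|X ω a| + |X' ω a|)) Q :=
    integrable_finsetSum _ fun a _ => ((hXi a).abs.add (hX'i a).abs).const_mul A
  have hfint : ∀ θ, Integrable (fun ω => f (Z θ ω)) Q := fun θ =>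
    Integrable.mono' ((integrable_const |f 0|).add hbound) (hc.comp_aestronglyMeasurable (hZ θ))
      (ae_of_all _ fun ω => (hf.abs_le hA _).trans (add_le_add_right
        (Finset.sum_le_sum fun a _ => mul_le_mul_of_nonneg_left (hZle θ ω a) hA0) _))
  have hterm : ∀ θ a, Integrable (fun ω => f1 a (Z θ ω) * V θ ω a) Q := fun θ a =>
    (hVZ θ a).fst.integrable.bdd_mul (c := A) ((hc1 a).comp_aestronglyMeasurable (hZ θ))
      (ae_of_all _ fun ω => hA a _)
  have hderiv : ∀ θ, HasDerivAt (fun θ => ∫ ω, f (Z θ ω) ∂Q)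
      (∫ ω, ∑ a, f1 a (Z θ ω) * V θ ω a ∂Q) θ := fun θ =>
    (hasDerivAt_integral_of_dominated_loc_of_deriv_le (s := Set.univ)
      (bound := fun ω => ∑ a, A * (|X ω a| + |X' ω a|)) Filter.univ_mem
      (Filter.Eventually.of_forall fun θ => (hfint θ).aestronglyMeasurable) (hfint θ)
      (integrable_finsetSum _ fun a _ => hterm θ a).aestronglyMeasurable
      (ae_of_all _ fun ω θ _ => by
        rw [Real.norm_eq_abs]
        refine (Finset.abs_sum_le_sum_abs _ _).trans (Finset.sum_le_sum fun a _ => ?_)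
        rw [abs_mul]
        exact mul_le_mul (hA _ _) (hVle θ ω a) (abs_nonneg _) hA0) hbound
      (ae_of_all _ fun ω θ _ => hf (fun θ => Z θ ω) (V θ ω) θ fun a =>
        ((hasDerivAt_cos θ).mul_const _).add ((hasDerivAt_sin θ).mul_const _))).2
  have hbd : ∀ θ, ‖∫ ω, ∑ a, f1 a (Z θ ω) * V θ ω a ∂Q‖ ≤ K * M := fun θ => by
    have hf2i : ∀ a b, Integrable (fun ω => f2 a b (Z θ ω)) Q := fun a b =>
      Integrable.of_bound ((hc2 a b).comp_aestronglyMeasurable (hZ θ)) K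
        (ae_of_all _ fun ω => hB a b _)
    have hV0 : ∀ a, ∫ ω, V θ ω a ∂Q = 0 := fun a => by
      change ∫ ω, (-sin θ * X ω a + cos θ * X' ω a) ∂Q = 0
      rw [integral_add ((hXi a).const_mul _) ((hX'i a).const_mul _), integral_const_mul,
        integral_const_mul, h0, h0']
      simp
    rw [integral_finsetSum _ fun a _ => hterm θ a, Real.norm_eq_abs]
    have hstein : ∀ a, ∫ ω, f1 a (Z θ ω) * V θ ω a ∂Q =
        ∑ b, cov[fun ω => V θ ω a, fun ω => Z θ ω b; Q] * ∫ ω, f2 a b (Z θ ω) ∂Q := fun a => by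
      rw [← integral_mul_comp_eq_sum_covariance_mul_integral (hVZ θ a) (hV0 a) (hf1 a) (hc1 a)
        (hc2 a) (hA a) (hB a)]
      simp only [mul_comm]
    have hcov : ∀ a b, |cov[fun ω => V θ ω a, fun ω => Z θ ω b; Q]| ≤ M := fun a b => by
      have h1 := covariance_rotation_velocity hX hX' hind h0 h0' θ a b
      change cov[fun ω => V θ ω a, fun ω => Z θ ω b; Q] = _ at h1
      rw [h1, abs_neg, abs_mul, abs_mul]
      refine (mul_le_of_le_one_left (abs_nonneg _) ?_).trans (hM a b)
      exact mul_le_one₀ (abs_sin_le_one θ) (abs_nonneg _) (abs_cos_le_one θ)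
    simp_rw [hstein]
    calc |∑ a, ∑ b, cov[fun ω => V θ ω a, fun ω => Z θ ω b; Q] * ∫ ω, f2 a b (Z θ ω) ∂Q|
        ≤ ∑ a, ∑ b, M * ∫ ω, |f2 a b (Z θ ω)| ∂Q := by
          refine (Finset.abs_sum_le_sum_abs _ _).trans (Finset.sum_le_sum fun a _ => ?_)
          refine (Finset.abs_sum_le_sum_abs _ _).trans (Finset.sum_le_sum fun b _ => ?_)
          rw [abs_mul]
          exact mul_le_mul (hcov a b) (abs_integral_le_integral_abs) (abs_nonneg _) hM0
      _ = M * ∫ ω, ∑ a, ∑ b, |f2 a b (Z θ ω)| ∂Q := by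
          rw [integral_finsetSum _ fun a _ => integrable_finsetSum _ fun b _ => (hf2i a b).abs,
            Finset.mul_sum]
          refine Finset.sum_congr rfl fun a _ => ?_
          rw [integral_finsetSum _ fun b _ => (hf2i a b).abs, Finset.mul_sum]
      _ ≤ M * ∫ ω, K ∂Q := by
          refine mul_le_mul_of_nonneg_left (integral_mono (integrable_finsetSum _ fun a _ =>
            integrable_finsetSum _ fun b _ => (hf2i a b).abs) (integrable_const K) fun ω => hK _) hM0
      _ = K * M := by simp [mul_comm]
  have hmv := Convex.norm_image_sub_le_of_norm_hasDerivWithin_le (s := Set.univ)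
    (fun θ _ => (hderiv θ).hasDerivWithinAt) (fun θ _ => hbd θ) convex_univ
    (Set.mem_univ (π / 2)) (Set.mem_univ 0)
  simp only [Z, cos_zero, sin_zero, cos_pi_div_two, sin_pi_div_two, zero_mul, one_mul, add_zero,
    zero_add, Real.norm_eq_abs, zero_sub, abs_neg] at hmv
  refine hmv.trans ?_
  rw [abs_of_pos (by positivity : 0 < π / 2)]
  have := Real.pi_le_four
  have := mul_nonneg hK0 hM0
  nlinarith

/-- Comparison of smooth functionals of two centered Gaussian vectors. -/
lemma abs_integral_sub_integral_le [Nonempty ι] (hX : HasGaussianLaw X Q)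
    (hX' : HasGaussianLaw X' Q) (hm : Measurable X) (hm' : Measurable X')
    (h0 : ∀ a, ∫ ω, X ω a ∂Q = 0) (h0' : ∀ a, ∫ ω, X' ω a ∂Q = 0)
    {f : (ι → ℝ) → ℝ} {f1 : ι → (ι → ℝ) → ℝ} {f2 : ι → ι → (ι → ℝ) → ℝ}
    (hf : HasGradientAlongCurves f f1) (hf1 : ∀ a, HasGradientAlongCurves (f1 a) (f2 a))
    (hc : Continuous f) (hc1 : ∀ a, Continuous (f1 a)) (hc2 : ∀ a b, Continuous (f2 a b))
    {A K M : ℝ} (hA : ∀ a x, |f1 a x| ≤ A) (hK : ∀ x, ∑ a, ∑ b, |f2 a b x| ≤ K)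
    (hM : ∀ a b, |∫ ω, X ω a * X ω b ∂Q - ∫ ω, X' ω a * X' ω b ∂Q| ≤ M) :
    |∫ ω, f (X ω) ∂Q - ∫ ω, f (X' ω) ∂Q| ≤ 2 * K * M := by
  have := hX.isProbabilityMeasure
  have e1 : ∀ k : Ω → ℝ, ∫ p, k p.1 ∂(Q.prod Q) = ∫ ω, k ω ∂Q := fun k => by
    simp [integral_fun_fst]
  have e2 : ∀ k : Ω → ℝ, ∫ p, k p.2 ∂(Q.prod Q) = ∫ ω, k ω ∂Q := fun k => by
    simp [integral_fun_snd]
  have g1 : HasGaussianLaw (fun p : Ω × Ω => X p.1) (Q.prod Q) := ⟨by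
    have h := hX.isGaussian_map
    have : (Q.prod Q).map (fun p : Ω × Ω => X p.1) = Q.map X := by
      rw [← Function.comp_def X, ← Measure.map_map hm measurable_fst]
      simp
    rwa [this]⟩
  have g2 : HasGaussianLaw (fun p : Ω × Ω => X' p.2) (Q.prod Q) := ⟨by
    have h := hX'.isGaussian_map
    have : (Q.prod Q).map (fun p : Ω × Ω => X' p.2) = Q.map X' := by
      rw [← Function.comp_def X', ← Measure.map_map hm' measurable_snd]
      simp
    rwa [this]⟩
  have h := abs_integral_sub_integral_le_of_indepFun (M := M) g1 g2 (indepFun_prod hm hm')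
    (fun a => by rw [e1 fun ω => X ω a, h0]) (fun a => by rw [e2 fun ω => X' ω a, h0'])
    hf hf1 hc hc1 hc2 hA hK (fun a b => by
      rw [e1 fun ω => X ω a * X ω b, e2 fun ω => X' ω a * X' ω b]
      exact hM a b)
  rwa [e1 fun ω => f (X ω), e2 fun ω => f (X' ω)] at h

end Interpolation

section SoftMinMax

variable {I J : Type*} [Fintype J]

/-- `log ∑ j, exp (β x i j)`. -/
noncomputable def rowLogSumExp (β : ℝ) (x : I × J → ℝ) (i : I) : ℝ :=
  Real.log (∑ j, Real.exp (β * x (i, j)))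

/-- The Gibbs weight of an entry within its row. -/
noncomputable def rowWeight (β : ℝ) (a : I × J) (x : I × J → ℝ) : ℝ :=
  Real.exp (β * x a - rowLogSumExp β x a.1)

section Rows

variable [Nonempty J]

lemma sum_exp_pos (β : ℝ) (x : I × J → ℝ) (i : I) : 0 < ∑ j, Real.exp (β * x (i, j)) :=
  Finset.sum_pos (fun _ _ => Real.exp_pos _) Finset.univ_nonempty

lemma sum_rowWeight (β : ℝ) (x : I × J → ℝ) (i : I) : ∑ j, rowWeight β (i, j) x = 1 := by
  have h := sum_exp_pos β x i
  simp only [rowWeight, Real.exp_sub, rowLogSumExp, Real.exp_log h]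
  rw [← Finset.sum_div, div_self h.ne']

lemma hasDerivAt_rowLogSumExp (β : ℝ) (x : ℝ → I × J → ℝ) (u : I × J → ℝ) (t : ℝ)
    (hx : ∀ a, HasDerivAt (fun s => x s a) (u a) t) (i : I) :
    HasDerivAt (fun s => rowLogSumExp β (x s) i)
      (β * ∑ j, rowWeight β (i, j) (x t) * u (i, j)) t := by
  have h := sum_exp_pos β (x t) i
  have h1 := (HasDerivAt.fun_sum (u := Finset.univ)
    fun j _ => ((hx (i, j)).const_mul β).exp).log h.ne'
  refine h1.congr_deriv ?_
  simp only [rowWeight, Real.exp_sub, rowLogSumExp, Real.exp_log h, Finset.sum_div,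
    Finset.mul_sum]
  exact Finset.sum_congr rfl fun j _ => by ring

lemma continuous_rowLogSumExp (β : ℝ) (i : I) :
    Continuous fun x : I × J → ℝ => rowLogSumExp β x i :=
  Continuous.log (by fun_prop) fun x => (sum_exp_pos β x i).ne'

lemma continuous_rowWeight (β : ℝ) (a : I × J) : Continuous (rowWeight β a) := by
  have := continuous_rowLogSumExp (J := J) β a.1
  unfold rowWeight
  fun_prop

end Rows

variable [Fintype I]

/-- `log ∑ i, (∑ j, exp (β x i j)) ^ (-δ)`. -/
noncomputable def logPartition (β δ : ℝ) (x : I × J → ℝ) : ℝ :=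
  Real.log (∑ i, Real.exp (-δ * rowLogSumExp β x i))

/-- The partial derivatives of the smooth min-max function. -/
noncomputable def entryWeight (β δ : ℝ) (a : I × J) (x : I × J → ℝ) : ℝ :=
  Real.exp (β * x a - (1 + δ) * rowLogSumExp β x a.1 - logPartition β δ x)

/-- The logarithmic derivatives of `entryWeight`. -/
noncomputable def entryWeightLogDeriv [DecidableEq I] [DecidableEq J] (β δ : ℝ) (a b : I × J)
    (x : I × J → ℝ) : ℝ :=
  β * (δ * entryWeight β δ b x - (1 + δ) * (if a.1 = b.1 then rowWeight β b x else 0) +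
    if a = b then 1 else 0)

lemma entryWeight_eq (β δ : ℝ) (a : I × J) (x : I × J → ℝ) :
    entryWeight β δ a x =
      Real.exp (-δ * rowLogSumExp β x a.1 - logPartition β δ x) * rowWeight β a x := by
  rw [entryWeight, rowWeight, ← Real.exp_add]
  ring_nf

lemma entryWeight_nonneg (β δ : ℝ) (a : I × J) (x : I × J → ℝ) : 0 ≤ entryWeight β δ a x :=
  (Real.exp_pos _).le

lemma sum_exp_rowLogSumExp_pos [Nonempty I] (β δ : ℝ) (x : I × J → ℝ) :
    0 < ∑ i, Real.exp (-δ * rowLogSumExp β x i) :=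
  Finset.sum_pos (fun _ _ => Real.exp_pos _) Finset.univ_nonempty

section Derivatives

variable [Nonempty I] [Nonempty J]

lemma sum_entryWeight (β δ : ℝ) (x : I × J → ℝ) : ∑ a, entryWeight β δ a x = 1 := by
  have h := sum_exp_rowLogSumExp_pos β δ x
  simp only [Fintype.sum_prod_type, entryWeight_eq, ← Finset.mul_sum, sum_rowWeight, mul_one]
  simp only [Real.exp_sub, logPartition, Real.exp_log h]
  rw [← Finset.sum_div, div_self h.ne']

lemma entryWeight_le_one (β δ : ℝ) (a : I × J) (x : I × J → ℝ) : entryWeight β δ a x ≤ 1 := by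
  rw [← sum_entryWeight β δ x]
  exact Finset.single_le_sum (f := fun a => entryWeight β δ a x)
    (fun b _ => entryWeight_nonneg β δ b x) (Finset.mem_univ a)

lemma hasDerivAt_logPartition (β δ : ℝ) (x : ℝ → I × J → ℝ) (u : I × J → ℝ) (t : ℝ)
    (hx : ∀ a, HasDerivAt (fun s => x s a) (u a) t) :
    HasDerivAt (fun s => logPartition β δ (x s))
      (-(δ * β) * ∑ a, entryWeight β δ a (x t) * u a) t := by
  have h := sum_exp_rowLogSumExp_pos β δ (x t)
  have h1 := (HasDerivAt.fun_sum (u := Finset.univ) fun i _ =>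
    ((hasDerivAt_rowLogSumExp β x u t hx i).const_mul (-δ)).exp).log h.ne'
  refine h1.congr_deriv ?_
  simp only [entryWeight_eq, Fintype.sum_prod_type]
  simp only [Real.exp_sub, logPartition, Real.exp_log h, Finset.sum_div, Finset.mul_sum]
  exact Finset.sum_congr rfl fun i _ => Finset.sum_congr rfl fun j _ => by ring

lemma continuous_logPartition (β δ : ℝ) :
    Continuous fun x : I × J → ℝ => logPartition β δ x := by
  have := continuous_rowLogSumExp (I := I) (J := J) β
  exact Continuous.log (by fun_prop) fun x => (sum_exp_rowLogSumExp_pos β δ x).ne'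

lemma continuous_entryWeight (β δ : ℝ) (a : I × J) : Continuous (entryWeight β δ a) := by
  have := continuous_rowLogSumExp (J := J) β a.1
  have := continuous_logPartition (I := I) (J := J) β δ
  unfold entryWeight
  fun_prop

variable [DecidableEq I] [DecidableEq J]

lemma continuous_entryWeightLogDeriv (β δ : ℝ) (a b : I × J) :
    Continuous (entryWeightLogDeriv β δ a b) := by
  have := continuous_entryWeight β δ b
  have := continuous_rowWeight β b
  unfold entryWeightLogDeriv
  split_ifs <;> fun_prop

lemma hasGradientAlongCurves_entryWeight (β δ : ℝ) (a : I × J) :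
    HasGradientAlongCurves (entryWeight β δ a)
      fun b x => entryWeight β δ a x * entryWeightLogDeriv β δ a b x := by
  intro x u t hx
  have h1 := ((((hx a).const_mul β).sub
    ((hasDerivAt_rowLogSumExp β x u t hx a.1).const_mul (1 + δ))).sub
    (hasDerivAt_logPartition β δ x u t hx)).exp
  refine h1.congr_deriv ?_
  change entryWeight β δ a (x t) * _ = _
  simp only [mul_assoc, ← Finset.mul_sum]
  congr 1
  have e1 : ∑ j, rowWeight β (a.1, j) (x t) * u (a.1, j) =
      ∑ b : I × J, (if a.1 = b.1 then rowWeight β b (x t) else 0) * u b := by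
    rw [Fintype.sum_prod_type, Finset.sum_eq_single a.1] <;> simp +contextual [eq_comm]
  have e2 : u a = ∑ b, (if a = b then 1 else 0) * u b := by simp
  rw [e1]
  nth_rewrite 1 [e2]
  simp only [entryWeightLogDeriv, Finset.mul_sum, ← Finset.sum_sub_distrib]
  refine Finset.sum_congr rfl fun b _ => ?_
  ring

lemma sum_abs_entryWeightLogDeriv_le {β δ : ℝ} (hβ : 0 < β) (hδ : 0 < δ) (a : I × J)
    (x : I × J → ℝ) : ∑ b, |entryWeightLogDeriv β δ a b x| ≤ 2 * (β * (1 + δ)) := by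
  have e1 : ∑ b : I × J, (if a.1 = b.1 then rowWeight β b x else 0) = 1 := by
    rw [← sum_rowWeight β x a.1, Fintype.sum_prod_type, Finset.sum_eq_single a.1] <;>
      simp +contextual [eq_comm]
  calc ∑ b, |entryWeightLogDeriv β δ a b x|
      ≤ ∑ b, β * (δ * entryWeight β δ b x +
          (1 + δ) * (if a.1 = b.1 then rowWeight β b x else 0) + if a = b then 1 else 0) := by
        refine Finset.sum_le_sum fun b _ => ?_
        have h1 : 0 ≤ δ * entryWeight β δ b x := mul_nonneg hδ.le (entryWeight_nonneg β δ b x)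
        have h2 : 0 ≤ (1 + δ) * (if a.1 = b.1 then rowWeight β b x else 0) := by
          have : 0 < rowWeight β b x := Real.exp_pos _
          split_ifs <;> positivity
        have h3 : (0 : ℝ) ≤ if a = b then 1 else 0 := by split_ifs <;> norm_num
        rw [entryWeightLogDeriv, abs_mul, abs_of_pos hβ]
        refine mul_le_mul_of_nonneg_left ?_ hβ.le
        rw [abs_le]
        constructor <;> linarith
    _ = 2 * (β * (1 + δ)) := by
        rw [← Finset.mul_sum, Finset.sum_add_distrib, Finset.sum_add_distrib, ← Finset.mul_sum,
          ← Finset.mul_sum, sum_entryWeight, e1]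
        simp
        ring

end Derivatives

end SoftMinMax

section Composition

variable {I J : Type*} [Fintype I] [Fintype J] [Nonempty I] [Nonempty J] {β δ : ℝ} {g : ℝ → ℝ}

/-- The chain rule for a function of the smooth min-max function. -/
lemma hasGradientAlongCurves_comp_smoothMinMax (hβ : 0 < β) (hδ : 0 < δ)
    (hg : Differentiable ℝ g) :
    HasGradientAlongCurves (fun x : I × J → ℝ => g (-(1 / (β * δ)) * logPartition β δ x))
      fun a x => deriv g (-(1 / (β * δ)) * logPartition β δ x) * entryWeight β δ a x := by
  intro x u t hx
  refine ((hg _).hasDerivAt.comp t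
    ((hasDerivAt_logPartition β δ x u t hx).const_mul (-(1 / (β * δ))))).congr_deriv ?_
  simp only [mul_assoc, ← Finset.mul_sum]
  field_simp

variable [DecidableEq I] [DecidableEq J]

lemma hasGradientAlongCurves_deriv_comp_smoothMinMax (hβ : 0 < β) (hδ : 0 < δ)
    (hg : Differentiable ℝ (deriv g)) (a : I × J) :
    HasGradientAlongCurves
      (fun x => deriv g (-(1 / (β * δ)) * logPartition β δ x) * entryWeight β δ a x)
      fun b x => deriv (deriv g) (-(1 / (β * δ)) * logPartition β δ x) *
          (entryWeight β δ a x * entryWeight β δ b x) +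
        deriv g (-(1 / (β * δ)) * logPartition β δ x) *
          (entryWeight β δ a x * entryWeightLogDeriv β δ a b x) := by
  intro x u t hx
  refine ((hasGradientAlongCurves_comp_smoothMinMax hβ hδ hg x u t hx).mul
    (hasGradientAlongCurves_entryWeight β δ a x u t hx)).congr_deriv ?_
  rw [Finset.sum_mul, Finset.mul_sum, ← Finset.sum_add_distrib]
  exact Finset.sum_congr rfl fun b _ => by ring

lemma sum_abs_deriv_deriv_comp_smoothMinMax_le (hβ : 0 < β) (hδ : 0 < δ) {A B : ℝ}
    (hA : ∀ t, |deriv g t| ≤ A) (hB : ∀ t, |deriv (deriv g) t| ≤ B) (x : I × J → ℝ) :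
    ∑ a, ∑ b, |deriv (deriv g) (-(1 / (β * δ)) * logPartition β δ x) *
          (entryWeight β δ a x * entryWeight β δ b x) +
        deriv g (-(1 / (β * δ)) * logPartition β δ x) *
          (entryWeight β δ a x * entryWeightLogDeriv β δ a b x)| ≤
      B + A * (2 * (β * (1 + δ))) := by
  have hA0 : 0 ≤ A := (abs_nonneg _).trans (hA 0)
  have hw := fun a => entryWeight_nonneg β δ a x
  calc _ ≤ ∑ a, ∑ b, entryWeight β δ a x *
        (B * entryWeight β δ b x + A * |entryWeightLogDeriv β δ a b x|) := by
        refine Finset.sum_le_sum fun a _ => Finset.sum_le_sum fun b _ => ?_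
        refine (abs_add_le _ _).trans ?_
        rw [abs_mul, abs_mul, abs_mul, abs_mul, abs_of_nonneg (hw a), abs_of_nonneg (hw b)]
        have h1 := mul_le_mul_of_nonneg_right (hB (-(1 / (β * δ)) * logPartition β δ x))
          (mul_nonneg (hw a) (hw b))
        have h2 := mul_le_mul_of_nonneg_right (hA (-(1 / (β * δ)) * logPartition β δ x))
          (mul_nonneg (hw a) (abs_nonneg (entryWeightLogDeriv β δ a b x)))
        linarith
    _ ≤ ∑ a, entryWeight β δ a x * (B + A * (2 * (β * (1 + δ)))) := by
        refine Finset.sum_le_sum fun a _ => ?_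
        rw [← Finset.mul_sum, Finset.sum_add_distrib, ← Finset.mul_sum, ← Finset.mul_sum,
          sum_entryWeight, mul_one]
        exact mul_le_mul_of_nonneg_left (add_le_add_right (mul_le_mul_of_nonneg_left
          (sum_abs_entryWeightLogDeriv_le hβ hδ a x) hA0) _) (hw a)
    _ = _ := by rw [← Finset.sum_mul, sum_entryWeight, one_mul]

end Composition

lemma Fbd_eq_logPartition {n m : ℕ} [Nonempty (Fin m)] (β δ : ℝ) (y : Fin n → Fin m → ℝ) :
    Fbd β δ y = -(1 / (β * δ)) * logPartition β δ (fun a => y a.1 a.2) := by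
  rw [Fbd, logPartition]
  congr 2
  refine Finset.sum_congr rfl fun i _ => ?_
  rw [Real.rpow_def_of_pos (sum_exp_pos β (fun a : Fin n × Fin m => y a.1 a.2) i), mul_comm]
  rfl

namespace IsCenteredGaussianMatrix

variable {Ω : Type*} [MeasurableSpace Ω] {P : Measure Ω} {n m : ℕ} {X : Ω → Fin n → Fin m → ℝ}

lemma hasGaussianLaw (h : IsCenteredGaussianMatrix P X) (hX : Measurable X) :
    HasGaussianLaw (fun ω (a : Fin n × Fin m) => X ω a.1 a.2) P := by
  have hm : Measurable fun ω (a : Fin n × Fin m) => X ω a.1 a.2 := by fun_prop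
  refine ⟨isGaussian_of_map_eq_gaussianReal fun L => ?_⟩
  obtain ⟨v, hv⟩ := h fun i j => L (Pi.single (i, j) 1)
  refine ⟨0, v, ?_⟩
  rw [Measure.map_map (by fun_prop) hm, ← hv]
  congr 1
  ext ω
  refine (L.toLinearMap.pi_apply_eq_sum_univ fun a => X ω a.1 a.2).trans ?_
  rw [Fintype.sum_prod_type]
  refine Finset.sum_congr rfl fun i _ => Finset.sum_congr rfl fun j _ => ?_
  rw [smul_eq_mul, mul_comm, ContinuousLinearMap.coe_coe]
  congr 2
  ext b
  simp [Pi.single_apply, eq_comm]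

lemma integral_eq_zero (h : IsCenteredGaussianMatrix P X) (hX : Measurable X) (i : Fin n)
    (j : Fin m) : ∫ ω, X ω i j ∂P = 0 := by
  obtain ⟨v, hv⟩ := h fun i' j' => if i = i' then if j = j' then 1 else 0 else 0
  have hm : Measurable fun ω => X ω i j := by fun_prop
  have : P.map (fun ω => X ω i j) = gaussianReal 0 v := by
    rw [← hv]
    congr 1
    ext ω
    simp [ite_mul]
  rw [← integral_map (f := fun x => x) hm.aemeasurable (by fun_prop), this]
  simp

end IsCenteredGaussianMatrix

lemma le_iSup_iSup_iSup_iSup {n m : ℕ} (k : Fin n → Fin m → Fin n → Fin m → ℝ) (i₁ : Fin n)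
    (j₁ : Fin m) (i₂ : Fin n) (j₂ : Fin m) :
    k i₁ j₁ i₂ j₂ ≤ ⨆ i₁, ⨆ j₁, ⨆ i₂, ⨆ j₂, k i₁ j₁ i₂ j₂ :=
  (le_ciSup (Set.finite_range fun j₂ => k i₁ j₁ i₂ j₂).bddAbove j₂).trans <|
    (le_ciSup (Set.finite_range fun i₂ => ⨆ j₂, k i₁ j₁ i₂ j₂).bddAbove i₂).trans <|
    (le_ciSup (Set.finite_range fun j₁ => ⨆ i₂, ⨆ j₂, k i₁ j₁ i₂ j₂).bddAbove j₁).trans <|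
    le_ciSup (Set.finite_range fun i₁ => ⨆ j₁, ⨆ i₂, ⨆ j₂, k i₁ j₁ i₂ j₂).bddAbove i₁

theorem stmt_16 (C₀ : ℝ) (hC₀ : 0 < C₀) :
    ∃ C : ℝ, 0 < C ∧
      ∀ (n m : ℕ), 1 ≤ n → 1 ≤ m →
      ∀ (Ω : Type) [MeasurableSpace Ω] (P : Measure Ω), IsProbabilityMeasure P →
      ∀ (Y Y' : Ω → Fin n → Fin m → ℝ), Measurable Y → Measurable Y' →
      IsCenteredGaussianMatrix P Y → IsCenteredGaussianMatrix P Y' →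
      ∀ (β δ τ : ℝ), 0 < β → 0 < δ → 1 / (β * (1 + δ)) < τ →
      ∀ g : ℝ → ℝ, ContDiff ℝ (⊤ : ℕ∞) g →
      (∀ t, |deriv g t| ≤ τ⁻¹) →
      (∀ t, |deriv (deriv g) t| ≤ C₀ * β * (1 + δ) * τ⁻¹) →
      |(∫ ω, g (Fbd β δ (Y ω)) ∂P) - ∫ ω, g (Fbd β δ (Y' ω)) ∂P| ≤
        C * β * (1 + δ) / τ *
          ⨆ i₁, ⨆ j₁, ⨆ i₂, ⨆ j₂,
            |∫ ω, (Y ω i₁ j₁ * Y ω i₂ j₂ - Y' ω i₁ j₁ * Y' ω i₂ j₂) ∂P| := by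
  refine ⟨2 * (C₀ + 2), by positivity, ?_⟩
  intro n m hn hm Ω _ P _ Y Y' hY hY' hYg hYg' β δ τ hβ hδ hτ g hg hg1 hg2
  have : Nonempty (Fin n) := ⟨⟨0, hn⟩⟩
  have : Nonempty (Fin m) := ⟨⟨0, hm⟩⟩
  have hτ0 : 0 < τ := lt_trans (by positivity) hτ
  have hd0 : Differentiable ℝ g := hg.differentiable (by simp)
  have hd1 : Differentiable ℝ (deriv g) :=
    (contDiff_infty_iff_deriv.1 hg).2.differentiable (by simp)
  have hG := hYg.hasGaussianLaw hY
  have hG' := hYg'.hasGaussianLaw hY'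
  have hYm : Measurable fun ω (a : Fin n × Fin m) => Y ω a.1 a.2 := by fun_prop
  have hYm' : Measurable fun ω (a : Fin n × Fin m) => Y' ω a.1 a.2 := by fun_prop
  have hL : ∀ a : Fin n × Fin m, MemLp (fun ω => Y ω a.1 a.2) 2 P := fun a =>
    (hG.map_fun (.proj a)).memLp_two
  have hL' : ∀ a : Fin n × Fin m, MemLp (fun ω => Y' ω a.1 a.2) 2 P := fun a =>
    (hG'.map_fun (.proj a)).memLp_two
  have key := abs_integral_sub_integral_le hG hG' hYm hYm'
    (fun a => hYg.integral_eq_zero hY a.1 a.2) (fun a => hYg'.integral_eq_zero hY' a.1 a.2)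
    (hasGradientAlongCurves_comp_smoothMinMax hβ hδ hd0)
    (hasGradientAlongCurves_deriv_comp_smoothMinMax hβ hδ hd1)
    (hg.continuous.comp (continuous_const.mul (continuous_logPartition β δ)))
    (fun a => ((hg.continuous_deriv (by simp)).comp
      (continuous_const.mul (continuous_logPartition β δ))).mul (continuous_entryWeight β δ a))
    (fun a b => by
      have h1 := hg.continuous_deriv (by simp)
      have h2 := (contDiff_infty_iff_deriv.1 hg).2.continuous_deriv (by simp)
      have h3 := continuous_logPartition (I := Fin n) (J := Fin m) β δ
      have h4 := continuous_entryWeight (I := Fin n) (J := Fin m) β δ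
      have h5 := continuous_entryWeightLogDeriv β δ a b
      have h6 := h4 a
      have h7 := h4 b
      fun_prop)
    (A := τ⁻¹) (K := (C₀ + 2) * β * (1 + δ) * τ⁻¹)
    (M := ⨆ i₁, ⨆ j₁, ⨆ i₂, ⨆ j₂,
      |∫ ω, (Y ω i₁ j₁ * Y ω i₂ j₂ - Y' ω i₁ j₁ * Y' ω i₂ j₂) ∂P|)
    (fun a x => by
      rw [abs_mul, abs_of_nonneg (entryWeight_nonneg β δ a x)]
      exact (mul_le_of_le_one_right (abs_nonneg _) (entryWeight_le_one β δ a x)).trans (hg1 _))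
    (fun x => by
      refine (sum_abs_deriv_deriv_comp_smoothMinMax_le hβ hδ hg1 hg2 x).trans_eq (by ring))
    (fun a b => by
      have h1 : Integrable (fun ω => Y ω a.1 a.2 * Y ω b.1 b.2) P := (hL a).integrable_mul (hL b)
      have h2 : Integrable (fun ω => Y' ω a.1 a.2 * Y' ω b.1 b.2) P :=
        (hL' a).integrable_mul (hL' b)
      rw [← integral_sub h1 h2]
      exact le_iSup_iSup_iSup_iSup (fun i₁ j₁ i₂ j₂ =>
        |∫ ω, (Y ω i₁ j₁ * Y ω i₂ j₂ - Y' ω i₁ j₁ * Y' ω i₂ j₂) ∂P|) a.1 a.2 b.1 b.2)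
  simp only [Fbd_eq_logPartition]
  refine key.trans_eq ?_
  ring
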